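/- Let μ = (μ_1 ≥ … ≥ μ_ℓ) be a partition of n and let σ ∈ S_n be a permutation of cycle type μ. For all α ∈ ℕ^m and β ∈ ℕ^{m'}, the trace of the action of σ on the homogeneous component R_{α,β} is equal to Σ ∏_{i : |A_i| odd} (−1)^{μ_i + 1}, where the sum runs over all ℓ-tuples of pairs (M_1,A_1),…,(M_ℓ,A_ℓ), with each M_i a finite multiset with entries in {1,…,m} and each A_i a subset of {1,…,m'}, satisfying Σ_{i=1}^{ℓ} μ_i·(multiplicity of j in M_i) = α_j for every j and Σ_{i : j' ∈ A_i} μ_i = β_{j'} for every j'. -/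

import Mathlib

set_option maxHeartbeats 1000000

open scoped TensorProduct

/-- A colored multiset in the alphabet `{1,…,m} ∪ {1̄,…,m̄'}`: the function records the
multiplicity of each unbarred entry, the finset records the (unrepeated) barred entries. -/
abbrev CMS (m m' : ℕ) := (Fin m → ℕ) × Finset (Fin m')

/-- The size `|S|` of a colored multiset. -/
def CMS.size {m m' : ℕ} (S : CMS m m') : ℕ := (∑ j, S.1 j) + S.2.card

/-- The ring `ℂ[X_{n×m}; Θ_{n×m'}]`. -/
abbrev R (n m m' : ℕ) := MvPolynomial (Fin n × Fin m) ℂ ⊗[ℂ] ExteriorAlgebra ℂ ((Fin n × Fin m') → ℂ)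

/-- The anticommuting generator `θ_{ij'}`. -/
noncomputable def theta (n m m' : ℕ) (i : Fin n) (j' : Fin m') : R n m m' :=
  1 ⊗ₜ ExteriorAlgebra.ι ℂ (Pi.single (i, j') 1)

/-- The monomial `x_{r1}^{a_1}⋯x_{rm}^{a_m}·θ_{r s_1}⋯θ_{r s_k}` attached to a row `r` and a
colored multiset `S` (the `θ`-factors taken in increasing order of the barred indices). -/
noncomputable def mon (n m m' : ℕ) (r : Fin n) (S : CMS m m') : R n m m' :=
  ((∏ j, MvPolynomial.X (r, j) ^ S.1 j : MvPolynomial (Fin n × Fin m) ℂ) ⊗ₜ[ℂ] 1) *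
    ((S.2.sort (· ≤ ·)).map (fun j' => theta n m m' r j')).prod

/-- The power sum generator `p_S`. -/
noncomputable def pS (n : ℕ) {m m' : ℕ} (S : CMS m m') : R n m m' :=
  ∑ r : Fin n, mon n m m' r S

/-- The action of `σ ∈ S_n` on `R` by algebra automorphisms, `σ·x_{ij} = x_{σ(i)j}` and
`σ·θ_{ij'} = θ_{σ(i)j'}`. -/
noncomputable def act {n m m' : ℕ} (σ : Equiv.Perm (Fin n)) : R n m m' →ₐ[ℂ] R n m m' :=
  Algebra.TensorProduct.map
    (MvPolynomial.rename (fun p => (σ p.1, p.2)))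
    (ExteriorAlgebra.map (LinearMap.funLeft ℂ ℂ (fun p => (σ⁻¹ p.1, p.2))))

/-- The product of the generators `θ_p` over a finite set `E` of indices (in some fixed order). -/
noncomputable def thetaMon (n m' : ℕ) (E : Finset (Fin n × Fin m')) :
    ExteriorAlgebra ℂ ((Fin n × Fin m') → ℂ) :=
  (E.toList.map (fun p => ExteriorAlgebra.ι ℂ (Pi.single p 1))).prod

/-- The homogeneous component `R_{α,β}` of `R`: the span of the products of generators of
total degree `α_j` in `x_{1j},…,x_{nj}` for each `j` and total degree `β_{j'}` in
`θ_{1j'},…,θ_{nj'}` for each `j'`. -/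
noncomputable def component (n m m' : ℕ) (α : Fin m → ℕ) (β : Fin m' → ℕ) :
    Submodule ℂ (R n m m') :=
  Submodule.span ℂ
    {z : R n m m' | ∃ (d : (Fin n × Fin m) →₀ ℕ) (E : Finset (Fin n × Fin m')),
      (∀ j, (∑ i, d (i, j)) = α j) ∧
      (∀ j', (E.filter (fun p => p.2 = j')).card = β j') ∧
      z = (MvPolynomial.monomial d 1) ⊗ₜ[ℂ] thetaMon n m' E}


lemma trace_restrict_aux {ι V : Type*} [AddCommGroup V] [Module ℂ V] (b : Module.Basis ι ℂ V)
    (S : Set ι) (hS : S.Finite) (W : Submodule ℂ V)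
    (hW : W = Submodule.span ℂ (Set.range (fun s : S => b s))) (f : V →ₗ[ℂ] V)
    (h : ∀ z ∈ W, f z ∈ W) :
    LinearMap.trace ℂ W (f.restrict h) = ∑ᶠ s ∈ S, b.repr (f (b s)) s := by
  classical
  subst hW
  have : Fintype S := hS.fintype
  have hli : LinearIndependent ℂ (fun s : S => b s) :=
    b.linearIndependent.comp _ Subtype.val_injective
  set bS := Module.Basis.span hli with hbS
  have hrepr : ∀ (x : Submodule.span ℂ (Set.range (fun s : S => b s))) (s : S),
      bS.repr x s = b.repr (x : V) s := by
    intro x s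
    have : (Finsupp.lapply s ∘ₗ bS.repr.toLinearMap) =
        (Finsupp.lapply (s : ι) ∘ₗ b.repr.toLinearMap ∘ₗ Submodule.subtype _) := by
      apply bS.ext
      intro t
      have : ((bS t : _) : V) = b t := by
        rw [hbS]; rw [Module.Basis.span_apply hli t]
      simp [this, Finsupp.single_apply, Subtype.ext_iff]
    exact LinearMap.congr_fun this x
  rw [LinearMap.trace_eq_matrix_trace ℂ bS, Matrix.trace, finsum_mem_eq_finite_toFinset_sum _ hS]
  simp only [Matrix.diag_apply, LinearMap.toMatrix_apply, hrepr]
  have hb : ∀ t, ((bS t : _) : V) = b t := by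
    intro t; rw [hbS]; rw [Module.Basis.span_apply hli t]
  simp only [LinearMap.restrict_apply, hb]
  rw [Finset.sum_subtype (p := (· ∈ S)) hS.toFinset (by simp) (fun s => b.repr (f (b s)) s)]

lemma exists_equiv_get {Q : Type*} [Fintype Q] (f : Q → ℕ) (l : List ℕ)
    (h : (Finset.univ.val.map f : Multiset ℕ) = ↑l) :
    ∃ e : Q ≃ Fin l.length, ∀ q, l.get (e q) = f q := by
  classical
  have hc : ∀ c, Nonempty ({a // f a = c} ≃ {b // l.get b = c}) := by
    intro c
    rw [← Fintype.card_eq, Fintype.card_subtype, Fintype.card_subtype]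
    have h2 : (Finset.univ.val.map l.get : Multiset ℕ) = ↑l := by
      have : (Finset.univ.val : Multiset (Fin l.length)) = ↑(List.finRange l.length) := rfl
      rw [this, Multiset.map_coe]; simp
    have := congrArg (Multiset.count c) (h.trans h2.symm)
    rw [Multiset.count_map, Multiset.count_map] at this
    simp only [Finset.card, Finset.filter_val]
    simpa [eq_comm] using this
  let e := Equiv.ofFiberEquiv (fun c => (hc c).some)
  exact ⟨e, fun q => Equiv.ofFiberEquiv_map _ q⟩

open Equiv.Perm in
lemma card_fib {n : ℕ} (σ : Equiv.Perm (Fin n)) (x : Fin n) (hx : σ x ≠ x) :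
    (Finset.univ.filter (fun i => σ.SameCycle x i)).card = (σ.cycleOf x).support.card := by
  congr 1; ext y
  simp [mem_support_cycleOf_iff' hx]

open Equiv.Perm in
lemma card_fib_fix {n : ℕ} (σ : Equiv.Perm (Fin n)) (x : Fin n) (hx : σ x = x) :
    (Finset.univ.filter (fun i => σ.SameCycle x i)).card = 1 := by
  rw [Finset.card_eq_one]; refine ⟨x, ?_⟩
  ext y
  have : Function.IsFixedPt σ x := hx
  simp only [Finset.mem_filter, Finset.mem_univ, true_and, Finset.mem_singleton]
  constructor
  · intro h; exact (h.eq_of_left this).symm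
  · rintro rfl; exact SameCycle.refl _ _

open Equiv.Perm in
lemma sign_cycleOf_fib {n : ℕ} (σ : Equiv.Perm (Fin n)) (x : Fin n) :
    Equiv.Perm.sign (σ.cycleOf x) =
      (-1) ^ ((Finset.univ.filter (fun i => σ.SameCycle x i)).card + 1) := by
  by_cases hx : σ x = x
  · rw [card_fib_fix σ x hx, (cycleOf_eq_one_iff σ).2 hx]; simp
  · rw [card_fib σ x hx, (isCycle_cycleOf σ hx).sign, pow_succ]; simp

open Equiv.Perm in
lemma parts_lemma {n : ℕ} (σ : Equiv.Perm (Fin n)) [Fintype (Quotient (SameCycle.setoid σ))]  :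
    (Finset.univ.val.map (fun q : Quotient (SameCycle.setoid σ) =>
      (Finset.univ.filter (fun i => σ.SameCycle q.out i)).card) : Multiset ℕ) = σ.partition.parts := by
  classical
  set sz := (fun q : Quotient (SameCycle.setoid σ) =>
      (Finset.univ.filter (fun i => σ.SameCycle q.out i)).card) with hsz
  have hsum : (Finset.univ.val.map sz).sum = n := by
    have := Finset.card_eq_sum_card_fiberwise (s := (Finset.univ : Finset (Fin n)))
      (t := (Finset.univ : Finset (Quotient (SameCycle.setoid σ)))) 
      (f := fun i => Quotient.mk (SameCycle.setoid σ) i) (by simp)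
    rw [Finset.card_univ, Fintype.card_fin] at this
    refine Eq.trans ?_ this.symm
    change ∑ q, sz q = _
    refine Finset.sum_congr rfl fun q _ => ?_
    rw [hsz]; dsimp only
    congr 1; ext i
    simp only [Finset.mem_filter, Finset.mem_univ, true_and]
    conv_rhs => rw [← Quotient.out_eq q]
    rw [Quotient.eq]
    exact ⟨fun h => h.symm, fun h => Equiv.Perm.SameCycle.symm h⟩
  have hsplit : (Finset.univ.val : Multiset (Quotient (SameCycle.setoid σ))) =
    (Finset.univ.filter (fun q : Quotient (SameCycle.setoid σ) => σ q.out ≠ q.out)).val +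
    (Finset.univ.filter (fun q : Quotient (SameCycle.setoid σ) => ¬ σ q.out ≠ q.out)).val := by
    simp only [Finset.filter_val]
    rw [Multiset.filter_add_not]
  have hA : (Finset.univ.filter (fun q : Quotient (SameCycle.setoid σ) => σ q.out ≠ q.out)).val.map sz
      = σ.cycleType := by
    have hinj : Set.InjOn (fun q : Quotient (SameCycle.setoid σ) => σ.cycleOf q.out)
        (Finset.univ.filter (fun q : Quotient (SameCycle.setoid σ) => σ q.out ≠ q.out)) := by
      intro q hq q' hq' h
      simp only [Finset.coe_filter, Finset.mem_univ, true_and, Set.mem_ofPred_eq] at hq hq' h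
      rw [← Quotient.out_eq q, ← Quotient.out_eq q', Quotient.eq]
      have : q'.out ∈ (σ.cycleOf q.out).support := by
        rw [h, mem_support_cycleOf_iff' hq']
      rw [mem_support_cycleOf_iff' hq] at this
      exact this
    have himg : σ.cycleFactorsFinset = (Finset.univ.filter
        (fun q : Quotient (SameCycle.setoid σ) => σ q.out ≠ q.out)).image
          (fun q => σ.cycleOf q.out) := by
      ext c
      simp only [Finset.mem_image, Finset.mem_filter, Finset.mem_univ, true_and]
      constructor
      · intro hc
        obtain ⟨x, hx, hcx⟩ : ∃ x, σ x ≠ x ∧ c = σ.cycleOf x := by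
          have hc' := (mem_cycleFactorsFinset_iff.1 hc).1
          obtain ⟨x, hx, -⟩ := hc'
          have hxs : x ∈ c.support := by simpa using hx
          refine ⟨x, ?_, cycle_is_cycleOf hxs hc⟩
          have := mem_cycleFactorsFinset_support_le hc hxs
          simpa using this
        have hsc : σ.SameCycle (Quotient.mk (SameCycle.setoid σ) x).out x :=
          Quotient.mk_out (s := SameCycle.setoid σ) x
        refine ⟨Quotient.mk (SameCycle.setoid σ) x, ?_, ?_⟩
        · intro h; exact hx (hsc.apply_eq_self_iff.1 h)
        · rw [hcx, hsc.cycleOf_eq]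
      · rintro ⟨q, hq, rfl⟩
        rw [cycleOf_mem_cycleFactorsFinset_iff]; simpa using hq
    rw [cycleType_def, himg, Finset.image_val_of_injOn hinj, Multiset.map_map]
    refine Multiset.map_congr rfl fun q hq => ?_
    have : σ q.out ≠ q.out := by simpa using hq
    exact card_fib σ _ this
  obtain ⟨r, hB⟩ : ∃ r, (Finset.univ.filter (fun q : Quotient (SameCycle.setoid σ) =>
      ¬ σ q.out ≠ q.out)).val.map sz = Multiset.replicate r 1 := by
    refine ⟨_, Multiset.eq_replicate_card.2 ?_⟩
    intro b hb
    obtain ⟨q, hq, rfl⟩ := Multiset.mem_map.1 hb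
    have : σ q.out = q.out := by simpa using hq
    exact card_fib_fix σ _ this
  rw [hsplit, Multiset.map_add, hA, hB] at hsum ⊢
  rw [parts_partition]
  have : r = Fintype.card (Fin n) - σ.support.card := by
    simp [sum_cycleType] at hsum ⊢; omega
  rw [this]

lemma exists_color {n : ℕ} (σ : Equiv.Perm (Fin n)) (l : List ℕ)
    (hl : σ.partition.parts = ↑l) : ∃ c : Fin n → Fin l.length,
      (∀ i i', c i = c i' ↔ σ.SameCycle i i') ∧ Function.Surjective c ∧
      ∀ k, (Finset.univ.filter (fun i => c i = k)).card = l.get k := by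
  classical
  obtain ⟨e, he⟩ := exists_equiv_get _ l ((parts_lemma σ).trans hl)
  refine ⟨fun i => e (Quotient.mk _ i), ?_, ?_, ?_⟩
  · intro i i'
    rw [e.apply_eq_iff_eq, Quotient.eq]; rfl
  · intro k
    exact ⟨(e.symm k).out, by simp⟩
  · intro k
    obtain ⟨q, rfl⟩ := e.surjective k
    rw [he]; congr 1; ext i
    simp only [Finset.mem_filter, Finset.mem_univ, true_and, e.apply_eq_iff_eq]
    conv_lhs => rw [← Quotient.out_eq q]
    rw [Quotient.eq]
    exact ⟨fun h => Equiv.Perm.SameCycle.symm h, fun h => h.symm⟩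

noncomputable def gth {I : Type*} [DecidableEq I] (p : I) : ExteriorAlgebra ℂ (I → ℂ) :=
  ExteriorAlgebra.ι ℂ (Pi.single p 1)

noncomputable def gtm {I : Type*} [DecidableEq I] (E : Finset I) : ExteriorAlgebra ℂ (I → ℂ) :=
  (E.toList.map gth).prod

lemma perm_prod {I : Type*} [DecidableEq I] {l l' : List I} (h : l.Perm l') :
    ∃ u : ℂˣ, (l.map gth).prod = u • (l'.map (gth (I := I))).prod := by
  induction h with
  | nil => exact ⟨1, by simp⟩
  | cons x h ih =>
    obtain ⟨u, hu⟩ := ih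
    exact ⟨u, by simp only [List.map_cons, List.prod_cons, hu, mul_smul_comm]⟩
  | swap x y l =>
    refine ⟨-1, ?_⟩
    have := ExteriorAlgebra.ι_add_mul_swap (R := ℂ) (Pi.single (M := fun _ : I => ℂ) x (1:ℂ)) (Pi.single y 1)
    have h2 : gth y * gth x = - (gth x * gth y) := by
      rw [eq_neg_iff_add_eq_zero, add_comm]; exact this
    simp only [List.map_cons, List.prod_cons, ← mul_assoc, h2]
    simp
  | trans h1 h2 ih1 ih2 =>
    obtain ⟨u, hu⟩ := ih1
    obtain ⟨v, hv⟩ := ih2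
    exact ⟨u * v, by rw [hu, hv, mul_smul]⟩

lemma exists_basis {I : Type*} [DecidableEq I] [Fintype I] :
    ∃ b : Module.Basis (Finset I) ℂ (ExteriorAlgebra ℂ (I → ℂ)), ∀ E, b E = gtm E := by
  classical
  let : LinearOrder I := LinearOrder.lift' (Fintype.equivFin I) (Fintype.equivFin I).injective
  let b0 := (Pi.basisFun ℂ I).ExteriorAlgebra
  have h : ∀ E, ∃ u : ℂˣ, gtm E = u • b0 E := by
    intro E
    have h1 : b0 E = ((List.ofFn (Set.powersetCard.ofFinEmbEquiv.symm
        (Set.powersetCard.ofCard (s := E) rfl))).map gth).prod := by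
      rw [ExteriorAlgebra.basis_apply_ofCard _ rfl, ExteriorAlgebra.ιMulti_family,
        ExteriorAlgebra.ιMulti_apply, List.map_ofFn]
      congr 2
      ext i
      simp only [gth, Function.comp, Pi.basisFun_apply]
    rw [h1]
    apply perm_prod
    rw [List.perm_ext_iff_of_nodup (Finset.nodup_toList _)
      (List.nodup_ofFn_ofInjective (RelEmbedding.injective _))]
    intro a
    rw [List.mem_ofFn', Set.powersetCard.mem_range_ofFinEmbEquiv_symm_iff_mem]
    simp [Set.powersetCard.ofCard]
  choose u hu using h
  exact ⟨b0.unitsSMul u, fun E => by rw [Module.Basis.unitsSMul_apply, hu]⟩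

lemma prod_map_perm {I : Type*} [DecidableEq I] (τ : Equiv.Perm I) (E : Finset I) :
    ∃ u : ℂˣ, (E.toList.map (fun p => gth (τ p))).prod = u • gtm (E.map τ.toEmbedding) := by
  have : E.toList.map (fun p => gth (τ p)) = (E.toList.map τ).map gth := by simp
  rw [this]
  apply perm_prod
  rw [List.perm_ext_iff_of_nodup ((List.nodup_map_iff τ.injective).2 (Finset.nodup_toList _)) (Finset.nodup_toList _)]
  intro a
  simp only [List.mem_map, Finset.mem_toList, Finset.mem_map, Equiv.coe_toEmbedding]

lemma prod_map_sign {I : Type*} [DecidableEq I] (τ : Equiv.Perm I) (E : Finset I)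
    (h : ∀ x, τ x ∈ E ↔ x ∈ E) :
    (E.toList.map (fun p => gth (τ p))).prod =
      Equiv.Perm.sign (τ.subtypePerm (p := (· ∈ E)) h) • gtm E := by
  classical
  set l := E.toList with hl
  let v : Fin l.length → (I → ℂ) := fun i => Pi.single (l.get i) 1
  let e0 : Fin l.length ≃ {x // x ∈ E} :=
    (List.Nodup.getEquiv l (Finset.nodup_toList _)).trans
      (Equiv.subtypeEquivRight (by simp [hl]))
  have he0 : ∀ i, (e0 i : I) = l.get i := fun i => rfl
  let ρ : Equiv.Perm (Fin l.length) := e0.symm.permCongr (τ.subtypePerm (p := (· ∈ E)) h)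
  have hρ : ∀ i, l.get (ρ i) = τ (l.get i) := by
    intro i
    rw [← he0, ← he0]; simp [ρ]
  have h1 : gtm E = ExteriorAlgebra.ιMulti ℂ l.length v := by
    rw [ExteriorAlgebra.ιMulti_apply, gtm, ← hl]
    congr 1
    conv_lhs => rw [← List.ofFn_get l, List.map_ofFn]
    rfl
  have h2 : (l.map (fun p => gth (τ p))).prod = ExteriorAlgebra.ιMulti ℂ l.length (v ∘ ρ) := by
    rw [ExteriorAlgebra.ιMulti_apply]
    congr 1
    conv_lhs => rw [← List.ofFn_get l, List.map_ofFn]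
    congr 1
    ext i
    simp only [Function.comp, v, hρ, gth]
  rw [h2, h1, AlternatingMap.map_perm]
  congr 1
  exact Equiv.Perm.sign_permCongr _ _
lemma sign_compute {n m' ℓ : ℕ} (σ : Equiv.Perm (Fin n)) (c : Fin n → Fin ℓ)
    (hc : ∀ i i', c i = c i' ↔ σ.SameCycle i i') (hs : Function.Surjective c)
    (τ : Equiv.Perm (Fin n × Fin m')) (hτ : ∀ p, τ p = (σ p.1, p.2))
    (A : Fin ℓ → Finset (Fin m')) (E : Finset (Fin n × Fin m'))
    (hE : ∀ p, p ∈ E ↔ p.2 ∈ A (c p.1)) (h : ∀ x, τ x ∈ E ↔ x ∈ E) :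
    Equiv.Perm.sign (τ.subtypePerm (p := (· ∈ E)) h) =
      ∏ k ∈ Finset.univ.filter (fun k => Odd (A k).card),
        (-1) ^ ((Finset.univ.filter (fun i => c i = k)).card + 1) := by
  classical
  choose s hs using hs
  let g : Equiv.Perm (Fin ℓ × Fin m' × Fin n) :=
    Equiv.prodCongrRight (fun k => Equiv.prodCongrRight
      (fun j => if j ∈ A k then σ.cycleOf (s k) else 1))
  have hg : ∀ x, g x = (x.1, x.2.1, if x.2.1 ∈ A x.1 ∧ c x.2.2 = x.1 then σ x.2.2 else x.2.2) := by
    rintro ⟨k, j, i⟩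
    have : σ.SameCycle (s k) i ↔ c i = k := by
      rw [← hc, hs, eq_comm]
    simp only [g, Equiv.prodCongrRight_apply]
    by_cases hj : j ∈ A k
    · simp [hj, Equiv.Perm.cycleOf_apply, this]
    · simp [hj]
  have hcσ : ∀ i, c (σ i) = c i := fun i => (hc _ _).2 (Equiv.Perm.sameCycle_apply_left.2 (Equiv.Perm.SameCycle.refl _ _))
  have h1 : Equiv.Perm.sign (τ.subtypePerm (p := (· ∈ E)) h) = Equiv.Perm.sign g := by
    refine Equiv.Perm.sign_bij (fun x _ => (c x.1.1, x.1.2, x.1.1)) ?_ ?_ ?_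
    · rintro ⟨⟨i, j⟩, hx⟩ _ _
      have hj := (hE _).1 hx
      simp only at hj
      simp [hg, hτ, hj, hcσ]
    · rintro ⟨⟨i, j⟩, hx⟩ ⟨⟨i', j'⟩, hx'⟩ _ _ h
      simp at h ⊢
      tauto
    · rintro ⟨k, j, i⟩ hx
      rw [hg] at hx
      simp only [ne_eq, Prod.mk.injEq, true_and, ite_eq_right_iff, not_forall] at hx
      obtain ⟨⟨h1, h2⟩, h3⟩ := hx
      refine ⟨⟨(i, j), (hE _).2 (by simpa [h2] using h1)⟩, ?_, ?_⟩
      · intro h4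
        have := congrArg Subtype.val h4
        simp [hτ] at this
        exact h3 this
      · simp [h2]
  rw [h1, Equiv.Perm.sign_prodCongrRight, Finset.prod_filter]
  refine Finset.prod_congr rfl fun k _ => ?_
  rw [Equiv.Perm.sign_prodCongrRight]
  have h2 : ∀ j, Equiv.Perm.sign (if j ∈ A k then σ.cycleOf (s k) else 1) =
      if j ∈ A k then (-1) ^ ((Finset.univ.filter (fun i => c i = k)).card + 1) else 1 := by
    intro j
    split_ifs
    · rw [sign_cycleOf_fib]
      congr 4; ext i; rw [← hc, hs, eq_comm]
    · simp
  simp only [h2]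
  rw [Finset.prod_ite_mem, Finset.univ_inter, Finset.prod_const, ← pow_mul]
  split_ifs with ho
  · rw [mul_comm, pow_mul, ho.neg_one_pow]
  · rw [mul_comm, pow_mul, (Nat.not_odd_iff_even.1 ho).neg_one_pow, one_pow]

section main

variable {n m m' : ℕ}

lemma exists_basis_R (n m m' : ℕ) :
    ∃ b : Module.Basis (((Fin n × Fin m) →₀ ℕ) × Finset (Fin n × Fin m')) ℂ (R n m m'),
      ∀ d E, b (d, E) = (MvPolynomial.monomial d 1) ⊗ₜ[ℂ] thetaMon n m' E := by
  obtain ⟨bt, hbt⟩ := exists_basis (I := Fin n × Fin m')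
  refine ⟨(MvPolynomial.basisMonomials (Fin n × Fin m) ℂ).tensorProduct bt, fun d E => ?_⟩
  rw [Module.Basis.tensorProduct_apply, hbt, MvPolynomial.coe_basisMonomials]
  rfl

lemma act_apply (σ : Equiv.Perm (Fin n)) (d : (Fin n × Fin m) →₀ ℕ)
    (E : Finset (Fin n × Fin m')) :
    act σ ((MvPolynomial.monomial d 1) ⊗ₜ[ℂ] thetaMon n m' E : R n m m') =
      (MvPolynomial.monomial (d.equivMapDomain (Equiv.prodCongr σ (Equiv.refl _))) 1) ⊗ₜ[ℂ]
        (E.toList.map (fun p => gth ((Equiv.prodCongr σ (Equiv.refl (Fin m'))) p))).prod := by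
  rw [act, Algebra.TensorProduct.map_tmul, MvPolynomial.rename_monomial,
    Finsupp.equivMapDomain_eq_mapDomain, thetaMon, map_list_prod, List.map_map]
  congr 3
  ext1 p
  simp only [Function.comp, ExteriorAlgebra.map_apply_ι, gth]
  congr 1
  ext q
  obtain ⟨i, j⟩ := p
  obtain ⟨i', j'⟩ := q
  simp only [LinearMap.funLeft_apply, Pi.single_apply, Equiv.prodCongr_apply, Prod.map,
    Equiv.refl_apply, Prod.mk.injEq, Equiv.Perm.inv_def, Equiv.symm_apply_eq]

def goodSet (n m m' : ℕ) (α : Fin m → ℕ) (β : Fin m' → ℕ) :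
    Set (((Fin n × Fin m) →₀ ℕ) × Finset (Fin n × Fin m')) :=
  {x | (∀ j, (∑ i, x.1 (i, j)) = α j) ∧
      (∀ j', (x.2.filter (fun p => p.2 = j')).card = β j')}

lemma goodSet_finite (α : Fin m → ℕ) (β : Fin m' → ℕ) : (goodSet n m m' α β).Finite := by
  classical
  let D : (Fin n × Fin m) →₀ ℕ := Finsupp.equivFunOnFinite.symm (fun p => α p.2)
  refine ((Set.finite_Iic D).prod (Set.finite_univ)).subset ?_
  rintro ⟨d, E⟩ ⟨h1, h2⟩
  refine ⟨?_, trivial⟩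
  rintro ⟨i, j⟩
  change d (i, j) ≤ α j
  rw [← h1 j]
  exact Finset.single_le_sum (f := fun i => d (i, j)) (fun _ _ => Nat.zero_le _) (Finset.mem_univ i)

lemma act_apply' (σ : Equiv.Perm (Fin n)) (d : (Fin n × Fin m) →₀ ℕ)
    (E : Finset (Fin n × Fin m')) : ∃ u : ℂˣ,
    act σ ((MvPolynomial.monomial d 1) ⊗ₜ[ℂ] thetaMon n m' E : R n m m') =
      u • ((MvPolynomial.monomial (d.equivMapDomain (Equiv.prodCongr σ (Equiv.refl _))) 1) ⊗ₜ[ℂ]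
        thetaMon n m' (E.map (Equiv.prodCongr σ (Equiv.refl (Fin m'))).toEmbedding)) := by
  obtain ⟨u, hu⟩ := prod_map_perm (Equiv.prodCongr σ (Equiv.refl (Fin m'))) E
  refine ⟨u, ?_⟩
  rw [act_apply, hu, Units.smul_def, TensorProduct.tmul_smul]
  rfl

lemma act_mem (σ : Equiv.Perm (Fin n)) (α : Fin m → ℕ) (β : Fin m' → ℕ) :
    ∀ z ∈ component n m m' α β, @act n m m' σ z ∈ component n m m' α β := by
  suffices component n m m' α β ≤ (component n m m' α β).comap (@act n m m' σ).toLinearMap from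
    fun z hz => this hz
  conv_lhs => rw [component]
  rw [Submodule.span_le]
  rintro _ ⟨d, E, h1, h2, rfl⟩
  obtain ⟨u, hu⟩ := act_apply' (m := m) σ d E
  simp only [SetLike.mem_coe, Submodule.mem_comap, AlgHom.toLinearMap_apply]
  rw [hu, Units.smul_def]
  refine Submodule.smul_mem _ _ (Submodule.subset_span ⟨_, _, ?_, ?_, rfl⟩)
  · intro j
    rw [← h1 j]
    refine Fintype.sum_equiv σ.symm _ _ fun i => ?_
    simp [Finsupp.equivMapDomain_apply]
  · intro j
    rw [← h2 j, Finset.filter_map, Finset.card_map]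
    rfl

lemma component_eq (b : Module.Basis (((Fin n × Fin m) →₀ ℕ) × Finset (Fin n × Fin m')) ℂ (R n m m'))
    (hb : ∀ d E, b (d, E) = (MvPolynomial.monomial d 1) ⊗ₜ[ℂ] thetaMon n m' E)
    (α : Fin m → ℕ) (β : Fin m' → ℕ) :
    component n m m' α β = Submodule.span ℂ (Set.range (fun s : goodSet n m m' α β => b s)) := by
  rw [component]
  congr 1
  ext z
  constructor
  · rintro ⟨d, E, h1, h2, rfl⟩
    exact ⟨⟨(d, E), h1, h2⟩, hb d E⟩
  · rintro ⟨⟨⟨d, E⟩, h1, h2⟩, rfl⟩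
    exact ⟨d, E, h1, h2, hb d E⟩

end main

/-- If `σ ∈ S_n` has cycle type `μ = (μ_1,…,μ_ℓ)` (including fixed points),
the trace of the action of `σ` on the homogeneous component `R_{α,β}` equals
`Σ ∏_{i : |A_i| odd} (−1)^{μ_i+1}`, the sum over all `ℓ`-tuples of pairs `(M_i, A_i)` with
`M_i` a multiset over `{1,…,m}`, `A_i ⊆ {1,…,m'}`, `Σ_i μ_i·mult_j(M_i) = α_j` for all `j`,
and `Σ_{i : j' ∈ A_i} μ_i = β_{j'}` for all `j'`. -/
theorem trace_perm_component (n m m' : ℕ) (hn : 0 < n) (hm : 0 < m) (hm' : 0 < m')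
    (μ : Nat.Partition n) (σ : Equiv.Perm (Fin n)) (hσ : σ.partition.parts = μ.parts)
    (α : Fin m → ℕ) (β : Fin m' → ℕ) :
    ∃ h : ∀ z ∈ component n m m' α β, @act n m m' σ z ∈ component n m m' α β,
      LinearMap.trace ℂ (component n m m' α β)
          (LinearMap.restrict (@act n m m' σ).toLinearMap h) =
        ∑ᶠ P ∈ {P : Fin (μ.parts.toList.length) → Multiset (Fin m) × Finset (Fin m') |
            (∀ j, ∑ i, μ.parts.toList.get i * (P i).1.count j = α j) ∧
            (∀ j', ∑ i ∈ Finset.univ.filter (fun i => j' ∈ (P i).2),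
                μ.parts.toList.get i = β j')},
          ∏ i ∈ Finset.univ.filter (fun i => Odd ((P i).2.card)),
            (-1 : ℂ) ^ (μ.parts.toList.get i + 1) := by
  classical
  refine ⟨act_mem σ α β, ?_⟩
  obtain ⟨b, hb⟩ := exists_basis_R n m m'
  refine (trace_restrict_aux b (goodSet n m m' α β) (goodSet_finite α β) _ (component_eq b hb α β)
    (@act n m m' σ).toLinearMap (act_mem σ α β)).trans ?_
  generalize hl : μ.parts.toList = l
  have hl' : σ.partition.parts = ↑l := by rw [hσ, ← hl, Multiset.coe_toList]
  obtain ⟨c, hc, hsurj, hcard⟩ := exists_color σ l hl'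
  have hcσ : ∀ i, c (σ i) = c i := fun i =>
    (hc _ _).2 (Equiv.Perm.sameCycle_apply_left.2 (Equiv.Perm.SameCycle.refl _ _))
  let F : Set (((Fin n × Fin m) →₀ ℕ) × Finset (Fin n × Fin m')) :=
    {x | x.1.equivMapDomain (Equiv.prodCongr σ (Equiv.refl _)) = x.1 ∧
      x.2.map (Equiv.prodCongr σ (Equiv.refl (Fin m'))).toEmbedding = x.2}
  have hF : ∑ᶠ s ∈ goodSet n m m' α β, b.repr ((@act n m m' σ).toLinearMap (b s)) s =
      ∑ᶠ s ∈ goodSet n m m' α β ∩ F, b.repr ((@act n m m' σ).toLinearMap (b s)) s := by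
    refine finsum_mem_inter_support_eq' _ _ _ ?_
    rintro ⟨d, E⟩ hx
    refine ⟨fun h => ⟨h, ?_⟩, fun h => h.1⟩
    by_contra hne
    apply hx
    obtain ⟨u, hu⟩ := act_apply' (m := m) σ d E
    dsimp only
    rw [AlgHom.toLinearMap_apply, hb, hu, ← hb, Units.smul_def, map_smul, Module.Basis.repr_self,
      Finsupp.smul_apply, Finsupp.single_apply, if_neg, smul_zero]
    intro h
    rw [Prod.mk.injEq] at h
    exact hne h
  rw [hF]
  symm
  let Φ : (Fin l.length → Multiset (Fin m) × Finset (Fin m')) →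
      ((Fin n × Fin m) →₀ ℕ) × Finset (Fin n × Fin m') := fun P =>
    (Finsupp.equivFunOnFinite.symm (fun p => (P (c p.1)).1.count p.2),
      Finset.univ.filter (fun p => p.2 ∈ (P (c p.1)).2))
  have hΦ1 : ∀ P i j, (Φ P).1 (i, j) = (P (c i)).1.count j := fun P i j => rfl
  have hΦ2 : ∀ P p, p ∈ (Φ P).2 ↔ p.2 ∈ (P (c p.1)).2 := by
    intro P p; simp [Φ]
  have hsum : ∀ f : Fin l.length → ℕ, ∑ i, f (c i) = ∑ k, l.get k * f k := by
    intro f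
    rw [← Finset.sum_fiberwise Finset.univ c]
    refine Finset.sum_congr rfl fun k _ => ?_
    rw [Finset.sum_congr rfl (g := fun _ => f k), Finset.sum_const, hcard, smul_eq_mul]
    intro i hi
    rw [(Finset.mem_filter.1 hi).2]
  have hgood : ∀ P, Φ P ∈ goodSet n m m' α β ↔
      ((∀ j, ∑ i, l.get i * (P i).1.count j = α j) ∧
            (∀ j', ∑ i ∈ Finset.univ.filter (fun i => j' ∈ (P i).2),
                l.get i = β j')) := by
    intro P
    refine and_congr (forall_congr' fun j => ?_) (forall_congr' fun j => ?_)
    · simp only [hΦ1]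
      rw [hsum (fun k => (P k).1.count j)]
    · have h1 : ((Φ P).2.filter (fun p => p.2 = j)).card =
          (Finset.univ.filter (fun i => j ∈ (P (c i)).2)).card := by
        refine Finset.card_bij' (fun p _ => p.1) (fun i _ => (i, j)) ?_ ?_ ?_ ?_
        · rintro ⟨i, j'⟩ h
          simp only [Finset.mem_filter, hΦ2] at h
          obtain ⟨h, rfl⟩ := h
          simpa using h
        · intro i h
          simp only [Finset.mem_filter, hΦ2]
          simpa using h
        · rintro ⟨i, j'⟩ h
          simp only [Finset.mem_filter] at h
          simp [h.2]
        · intro i h; rfl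
      rw [h1, Finset.card_filter, hsum (fun k => if j ∈ (P k).2 then 1 else 0)]
      simp only [mul_ite, mul_one, mul_zero]
      rw [← Finset.sum_filter]
  have hΦF : ∀ P, Φ P ∈ F := by
    intro P
    constructor
    · ext ⟨i, j⟩
      rw [Finsupp.equivMapDomain_apply]
      change (P (c (σ.symm i))).1.count j = (P (c i)).1.count j
      rw [← hcσ (σ.symm i), Equiv.apply_symm_apply]
    · ext ⟨i, j⟩
      rw [Finset.mem_map_equiv, hΦ2, hΦ2]
      change j ∈ (P (c (σ.symm i))).2 ↔ j ∈ (P (c i)).2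
      rw [← hcσ (σ.symm i), Equiv.apply_symm_apply]
  refine finsum_mem_eq_of_bijOn Φ ⟨?_, ?_, ?_⟩ ?_
  · intro P hP
    exact ⟨(hgood P).2 hP, hΦF P⟩
  · intro P _ P' _ h
    funext k
    obtain ⟨i, rfl⟩ := hsurj k
    refine Prod.ext ?_ ?_
    · ext j
      rw [← hΦ1, ← hΦ1, h]
    · ext j
      rw [← hΦ2 P (i, j), h, hΦ2]
  · rintro ⟨d, E⟩ ⟨hg, hd, hE⟩
    have hd1 : ∀ i j, d (σ i, j) = d (i, j) := by
      intro i j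
      have := DFunLike.congr_fun hd (σ i, j)
      rw [Finsupp.equivMapDomain_apply] at this
      simpa using this.symm
    have hE1 : ∀ i j, (σ i, j) ∈ E ↔ (i, j) ∈ E := by
      intro i j
      dsimp only at hE
      conv_lhs => rw [← hE, Finset.mem_map_equiv]
      simp
    have hcyc : ∀ (p : Fin n → Prop), (∀ i, p (σ i) ↔ p i) → ∀ i i', c i = c i' → (p i ↔ p i') := by
      intro p hp i i' h
      obtain ⟨k, -, -, rfl⟩ := ((hc i i').1 h).exists_pow_eq
      clear h
      induction k with
      | zero => simp
      | succ k ih => rw [pow_succ', Equiv.Perm.mul_apply, hp, ih]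
    choose s hs using hsurj
    let P : Fin l.length → Multiset (Fin m) × Finset (Fin m') := fun k =>
      (Finsupp.toMultiset (Finsupp.equivFunOnFinite.symm (fun j => d (s k, j))),
        Finset.univ.filter (fun j => (s k, j) ∈ E))
    have hP : Φ P = (d, E) := by
      refine Prod.ext ?_ ?_
      · ext ⟨i, j⟩
        rw [hΦ1]
        simp only [P, Finsupp.count_toMultiset]
        exact (hcyc (fun i' => d (i', j) = d (i, j)) (fun i' => by rw [hd1]) i _ (hs _).symm).1 rfl
      · ext ⟨i, j⟩
        rw [hΦ2]
        simp only [P, Finset.mem_filter, Finset.mem_univ, true_and]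
        exact hcyc (fun i' => (i', j) ∈ E) (fun i' => hE1 i' j) _ _ (hs _)
    refine ⟨P, ?_, hP⟩
    exact (hgood P).1 (hP ▸ hg)
  · intro P hP
    obtain ⟨hd, hE⟩ := hΦF P
    have hE1 : ∀ x, (Equiv.prodCongr σ (Equiv.refl (Fin m'))) x ∈ (Φ P).2 ↔ x ∈ (Φ P).2 := by
      intro x
      conv_lhs => rw [← hE, Finset.mem_map_equiv, Equiv.symm_apply_apply]
    have h1 := prod_map_sign (Equiv.prodCongr σ (Equiv.refl (Fin m'))) (Φ P).2 hE1
    rw [sign_compute σ c hc hsurj _ (fun p => rfl) (fun k => (P k).2) (Φ P).2 (hΦ2 P) hE1] at h1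
    simp only [hcard] at h1
    have h2 : b (Φ P) = (MvPolynomial.monomial (Φ P).1 1) ⊗ₜ[ℂ] thetaMon n m' (Φ P).2 := hb _ _
    have h3 : gtm (Φ P).2 = thetaMon n m' (Φ P).2 := rfl
    rw [AlgHom.toLinearMap_apply, h2, act_apply, h1, hd, h3, Units.smul_def, ← Int.cast_smul_eq_zsmul ℂ,
      TensorProduct.tmul_smul, ← h2, map_smul, Module.Basis.repr_self, Finsupp.smul_apply,
      Finsupp.single_eq_same, smul_eq_mul, mul_one]
    push_cast
    rfl
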